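/- arXiv:1606.03752 — 3 statements merged into one kernel-verified Lean document; each statement's English description precedes it below -/
import Mathlib

section
/- Let p, c ∈ ℝ² with d = dist(p, c), and let 0 < r < d. For any unit vector u ∈ ℝ², the ray {p + t·u : t ≥ 0} intersects the closed ball of radius r centered at c if and only if the angle between u and the vector c − p is at most arcsin(r/d). (This identifies the half-angle of the blocking cone of a diameter-2r body blockage at distance d.) -/
open Metric Real

/-- Expansion of the squared distance from a point of the ray to the target, split into the
components along and across the ray. -/
lemma sq_norm_smul_sub_eq_cos_angle_add_sin_angle {V : Type*} [NormedAddCommGroup V]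
    [InnerProductSpace ℝ V] {u : V} (hu : ‖u‖ = 1) (v : V) (t : ℝ) :
    ‖t • u - v‖ ^ 2 = (t - ‖v‖ * cos (InnerProductGeometry.angle u v)) ^ 2 +
      (‖v‖ * sin (InnerProductGeometry.angle u v)) ^ 2 := by
  have hinner := InnerProductGeometry.cos_angle_mul_norm_mul_norm u v
  rw [norm_sub_sq_real, norm_smul, real_inner_smul_left, ← hinner, hu, mul_one, one_mul,
    Real.norm_eq_abs, sq_abs]
  linear_combination -‖v‖ ^ 2 * sin_sq_add_cos_sq (InnerProductGeometry.angle u v)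

/-- The ray from `p` in unit direction `u` meets the closed disk of radius `r` centered at
`c` (with `0 < r < d = dist p c`) iff the angle between `u` and `c - p` is at most
`arcsin (r / d)`: the half-angle of the blocking cone. -/
theorem ray_hits_ball_iff_angle_le_arcsin
    (p c : EuclideanSpace ℝ (Fin 2)) (d r : ℝ) (hd : d = dist p c)
    (hr : 0 < r) (hrd : r < d)
    (u : EuclideanSpace ℝ (Fin 2)) (hu : ‖u‖ = 1) :
    (∃ t : ℝ, 0 ≤ t ∧ p + t • u ∈ closedBall c r) ↔
      InnerProductGeometry.angle u (c - p) ≤ arcsin (r / d) := by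
  have hd0 : 0 < d := hr.trans hrd
  have hnorm : ‖c - p‖ = d := by rw [hd, dist_comm, dist_eq_norm]
  have hmem (t : ℝ) : p + t • u ∈ closedBall c r ↔
      (t - d * cos (InnerProductGeometry.angle u (c - p))) ^ 2 +
        (d * sin (InnerProductGeometry.angle u (c - p))) ^ 2 ≤ r ^ 2 := by
    rw [← hnorm, ← sq_norm_smul_sub_eq_cos_angle_add_sin_angle hu, mem_closedBall, dist_eq_norm,
      show p + t • u - c = t • u - (c - p) by abel]
    exact (pow_le_pow_iff_left₀ (norm_nonneg _) hr.le two_ne_zero).symm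
  simp only [hmem]
  have h0 := InnerProductGeometry.angle_nonneg u (c - p)
  have hpi := InnerProductGeometry.angle_le_pi u (c - p)
  have hsin := InnerProductGeometry.sin_angle_nonneg u (c - p)
  generalize InnerProductGeometry.angle u (c - p) = θ at *
  have hratio : r / d < 1 := (div_lt_one hd0).2 hrd
  have hratio0 : 0 < r / d := div_pos hr hd0
  constructor
  · rintro ⟨t, ht, h⟩
    have hcos : 0 < cos θ := by
      by_contra! hcos
      have hexpand : (t - d * cos θ) ^ 2 + (d * sin θ) ^ 2 =
          t ^ 2 + 2 * (t * d * -cos θ) + d ^ 2 := by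
        linear_combination d ^ 2 * sin_sq_add_cos_sq θ
      have hrd2 : r ^ 2 < d ^ 2 := pow_lt_pow_left₀ hrd hr.le two_ne_zero
      linarith [mul_nonneg (mul_nonneg ht hd0.le) (neg_nonneg.2 hcos), sq_nonneg t]
    have hθ : θ < π / 2 := by
      by_contra! hθ
      exact hcos.not_ge (cos_nonpos_of_pi_div_two_le_of_le hθ (by linarith [pi_pos]))
    rw [le_arcsin_iff_sin_le ⟨by linarith [pi_pos], hθ.le⟩ ⟨by linarith, hratio.le⟩,
      le_div_iff₀ hd0, mul_comm]
    exact le_of_sq_le_sq (by linarith [sq_nonneg (t - d * cos θ)]) hr.le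
  · intro h
    have hθ : θ ≤ π / 2 := h.trans (arcsin_le_pi_div_two _)
    refine ⟨d * cos θ, mul_nonneg hd0.le (cos_nonneg_of_mem_Icc ⟨by linarith, hθ⟩), ?_⟩
    rw [le_arcsin_iff_sin_le ⟨by linarith, hθ⟩ ⟨by linarith, hratio.le⟩,
      le_div_iff₀ hd0, mul_comm] at h
    rw [sub_self, zero_pow two_ne_zero, zero_add]
    exact pow_le_pow_left₀ (mul_nonneg hd0.le hsin) h 2
end

section
/- Let m be a positive integer, let m̃ = (m!)^{−1/m}, and let h be a random variable with the Gamma distribution with shape m and rate m. Then for every x ≥ 0, the cumulative distribution function satisfies P(h ≤ x) ≥ (1 − e^{−m·m̃·x})^m. -/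
open MeasureTheory ProbabilityTheory Real

/-- The truncated exponential series is differentiated by dropping its last term. -/
lemma hasDerivAt_sum_range_pow_div_factorial (n : ℕ) (y : ℝ) :
    HasDerivAt (fun t : ℝ => ∑ k ∈ Finset.range (n + 1), t ^ k / (k.factorial : ℝ))
      (∑ k ∈ Finset.range n, y ^ k / (k.factorial : ℝ)) y := by
  induction n with
  | zero => simpa using hasDerivAt_const y (1 : ℝ)
  | succ n ih =>
    simp only [Finset.sum_range_succ _ (n + 1)]
    rw [Finset.sum_range_succ _ n]
    refine ih.add ?_
    refine ((hasDerivAt_pow (n + 1) y).div_const ((n + 1).factorial : ℝ)).congr_deriv ?_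
    rw [Nat.factorial_succ]
    push_cast
    field_simp

/-- The remainder of the exponential series dominates `e^y (1 - e^{-a})^m - a^m`. This is the
bathtub principle comparing the integrals of `exp (-∑ tᵢ)` over a cube of side `a` and over
the simplex `∑ tᵢ ≤ y`, with Lagrange multiplier `e^{-y}`. -/
lemma exp_mul_one_sub_exp_neg_pow_sub_pow_le {a : ℝ} (ha : 0 ≤ a) (m : ℕ) {y : ℝ} (hy : 0 ≤ y) :
    exp y * (1 - exp (-a)) ^ m - a ^ m ≤
      exp y - ∑ k ∈ Finset.range (m + 1), y ^ k / (k.factorial : ℝ) := by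
  induction m generalizing y with
  | zero => simp
  | succ m ih =>
    have hq0 : 0 ≤ 1 - exp (-a) := by
      have := exp_le_one_iff.2 (neg_nonpos.2 ha)
      linarith
    have hqa : 1 - exp (-a) ≤ a := by linarith [add_one_le_exp (-a)]
    set q := (1 - exp (-a)) ^ m with hq
    have hqpos : 0 ≤ q := pow_nonneg hq0 m
    have hqle : q ≤ a ^ m := pow_le_pow_left₀ hq0 hqa m
    set R : ℝ → ℝ := fun u =>
      exp u - ∑ k ∈ Finset.range (m + 1 + 1), u ^ k / (k.factorial : ℝ) with hR
    have hderiv : ∀ u, HasDerivAt (fun u => R u - exp u * q + a ^ m * u)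
        (exp u - (∑ k ∈ Finset.range (m + 1), u ^ k / (k.factorial : ℝ))
          - exp u * q + a ^ m * 1) u := fun u =>
      ((((hasDerivAt_exp u).sub (hasDerivAt_sum_range_pow_div_factorial (m + 1) u)).sub
        ((hasDerivAt_exp u).mul_const q)).add ((hasDerivAt_id u).const_mul (a ^ m)))
    have hmono : MonotoneOn (fun u => R u - exp u * q + a ^ m * u) (Set.Ici 0) := by
      refine monotoneOn_of_deriv_nonneg (convex_Ici 0)
        (fun u _ => (hderiv u).continuousAt.continuousWithinAt)
        (fun u _ => (hderiv u).differentiableAt.differentiableWithinAt) fun u hu => ?_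
      rw [interior_Ici] at hu
      rw [(hderiv u).deriv]
      linarith [ih (le_of_lt hu)]
    have hR0 : R 0 = 0 := by simp [hR, Finset.sum_range_succ']
    change exp y * (1 - exp (-a)) ^ (m + 1) - a ^ (m + 1) ≤ R y
    rw [pow_succ, pow_succ, ← hq]
    have hexp : exp (y - a) = exp y * exp (-a) := by rw [← exp_add, sub_eq_add_neg]
    rcases le_total a y with h | h
    · have h1 := hmono (Set.mem_Ici.2 (sub_nonneg.2 h)) (Set.mem_Ici.2 hy) (sub_le_self y ha)
      have h2 : 0 ≤ R (y - a) := by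
        have := sum_le_exp_of_nonneg (sub_nonneg.2 h) (m + 1 + 1)
        simp only [hR]
        linarith
      simp only [hexp] at h1
      linarith
    · have h1 := hmono (Set.mem_Ici.2 le_rfl) (Set.mem_Ici.2 hy) hy
      simp only [hR0, exp_zero] at h1
      have h2 : q * (1 - exp (y - a)) ≤ a ^ m * (a - y) :=
        mul_le_mul hqle (by linarith [add_one_le_exp (y - a)])
          (by linarith [exp_le_one_iff.2 (sub_nonpos.2 h)]) (pow_nonneg ha m)
      rw [hexp] at h2
      linarith

/-- The distribution function of the Erlang distribution. -/
lemma gammaMeasure_Iic_toReal_of_nat (n : ℕ) {r : ℝ} (hr : 0 < r) {x : ℝ} (hx : 0 ≤ x) :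
    ((gammaMeasure ((n + 1 : ℕ) : ℝ) r) (Set.Iic x)).toReal =
      1 - exp (-(r * x)) * ∑ k ∈ Finset.range (n + 1), (r * x) ^ k / (k.factorial : ℝ) := by
  have hn : (0 : ℝ) < ((n + 1 : ℕ) : ℝ) := by positivity
  have := isProbabilityMeasure_gammaMeasure hn hr
  have hderiv : ∀ t, HasDerivAt
      (fun t => -(exp (-(r * t)) * ∑ k ∈ Finset.range (n + 1), (r * t) ^ k / (k.factorial : ℝ)))
      (r ^ (n + 1) / (n.factorial : ℝ) * t ^ n * exp (-(r * t))) t := by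
    intro t
    have hl : HasDerivAt (fun t => r * t) r t := by
      simpa using (hasDerivAt_id t).const_mul r
    have hs := (hasDerivAt_sum_range_pow_div_factorial n (r * t)).comp t hl
    refine (hl.neg.exp.mul hs).neg.congr_deriv ?_
    simp only [Function.comp, Finset.sum_range_succ _ n, Pi.neg_apply, mul_pow]
    ring
  have hzero : ∫⁻ t in Set.Iio 0, gammaPDF ((n + 1 : ℕ) : ℝ) r t = 0 :=
    lintegral_gammaPDF_of_nonpos le_rfl
  have hint : ∫ t in (0 : ℝ)..x, r ^ (n + 1) / (n.factorial : ℝ) * t ^ n * exp (-(r * t)) =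
      1 - exp (-(r * x)) * ∑ k ∈ Finset.range (n + 1), (r * x) ^ k / (k.factorial : ℝ) := by
    rw [intervalIntegral.integral_eq_sub_of_hasDerivAt (fun t _ => hderiv t)
      (Continuous.intervalIntegrable (by fun_prop) _ _)]
    simp [Finset.sum_range_succ' _ n]
    ring
  rw [gammaMeasure, withDensity_apply _ measurableSet_Iic,
    lintegral_Iic_eq_lintegral_Iio_add_Icc _ hx, hzero, zero_add, ← hint,
    intervalIntegral.integral_of_le hx, ← integral_Icc_eq_integral_Ioc,
    integral_eq_lintegral_of_nonneg_ae]
  · congr 1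
    refine setLIntegral_congr_fun measurableSet_Icc fun t ht => ?_
    simp only [gammaPDF_of_nonneg ht.1, rpow_natCast]
    rw [Nat.cast_succ, Gamma_nat_eq_factorial, add_sub_cancel_right, rpow_natCast]
  · rw [Filter.EventuallyLE, ae_restrict_iff' measurableSet_Icc]
    refine ae_of_all _ fun t ht => ?_
    have := ht.1
    simp only [Pi.zero_apply]
    positivity
  · exact Continuous.aestronglyMeasurable (by fun_prop)

/-- Alzer's lower bound on the CDF of the normalized Gamma distribution with positive
integer parameter `m` (shape `m`, rate `m`): with `m̃ = (m!)^{-1/m}`, for every `x ≥ 0`,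
`P(h ≤ x) ≥ (1 - exp (-m m̃ x))^m`. -/
theorem gamma_cdf_alzer_lower_bound
    (m : ℕ) (hm : 0 < m) (mt : ℝ) (hmt : mt = (m.factorial : ℝ) ^ (-(1 : ℝ) / m))
    (x : ℝ) (hx : 0 ≤ x) :
    (1 - Real.exp (-((m : ℝ) * mt * x))) ^ m ≤
      ((gammaMeasure m m) (Set.Iic x)).toReal := by
  have hm' : (0 : ℝ) < m := Nat.cast_pos.2 hm
  have hmt0 : 0 ≤ mt := hmt ▸ by positivity
  have hpow : mt ^ m = (m.factorial : ℝ)⁻¹ := by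
    rw [hmt, ← rpow_mul_natCast (by positivity), div_mul_cancel₀ _ hm'.ne', rpow_neg_one]
  have hcdf : ((gammaMeasure m m) (Set.Iic x)).toReal =
      1 - exp (-(m * x)) * ∑ k ∈ Finset.range m, ((m : ℝ) * x) ^ k / (k.factorial : ℝ) := by
    obtain ⟨n, rfl⟩ := Nat.exists_eq_succ_of_ne_zero hm.ne'
    exact gammaMeasure_Iic_toReal_of_nat n hm' hx
  have hmain := exp_mul_one_sub_exp_neg_pow_sub_pow_le
    (a := m * mt * x) (by positivity) m (y := m * x) (by positivity)
  have ha : ((m : ℝ) * mt * x) ^ m = ((m : ℝ) * x) ^ m / (m.factorial : ℝ) := by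
    rw [mul_right_comm, mul_pow, hpow, div_eq_mul_inv]
  rw [Finset.sum_range_succ, ha] at hmain
  rw [hcdf, ← mul_le_mul_iff_right₀ (exp_pos ((m : ℝ) * x)), mul_sub, mul_one, ← mul_assoc,
    ← exp_add, add_neg_cancel, exp_zero, one_mul]
  linarith
end

section
/- Let m be a positive integer, m̃ = (m!)^{−1/m}, σ² ≥ 0 and γ̃ > 0. Let h₀ be a random variable with the Gamma distribution with shape m and rate m, and let I be a nonnegative random variable independent of h₀. Then P( h₀ > γ̃·(σ² + I) ) ≤ Σ_{k=1}^{m} C(m,k)·(−1)^{k+1}·e^{−k·m·m̃·γ̃·σ²}·E[ e^{−k·m·m̃·γ̃·I} ]. -/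
open MeasureTheory ProbabilityTheory Real

theorem one_sub_exp_neg_div_pos {u : ℝ} (hu : 0 < u) : 0 < (1 - exp (-u)) / u :=
  div_pos (sub_pos.2 (exp_lt_one_iff.2 (by linarith))) hu

/-- Monotonicity in `u` of the `L^u` norm of `t ↦ exp (-t)` on the unit interval. -/
theorem mul_log_one_sub_exp_neg_div_le {v u : ℝ} (hv : 0 < v) (hvu : v ≤ u) :
    u * log ((1 - exp (-v)) / v) ≤ v * log ((1 - exp (-u)) / u) := by
  have hu : 0 < u := hv.trans_le hvu
  have key : ∀ w : ℝ, 0 < w → ∫ t in (0 : ℝ)..1, exp (-(w * t)) = (1 - exp (-w)) / w := by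
    intro w hw
    rw [intervalIntegral.integral_eq_sub_of_hasDerivAt (f := fun t ↦ -exp (-(w * t)) / w)]
    · simp; ring
    · intro t _
      have := ((((hasDerivAt_id' t).const_mul w).fun_neg).exp.fun_neg).div_const w
      exact this.congr_deriv (by field_simp)
    · exact Continuous.intervalIntegrable (by fun_prop) _ _
  have : IsProbabilityMeasure (volume.restrict (Set.Ioc (0 : ℝ) 1)) := ⟨by simp⟩
  have hint : ∀ w : ℝ, Integrable (fun t ↦ exp (-(w * t))) (volume.restrict (Set.Ioc (0 : ℝ) 1)) :=
    fun w ↦ Continuous.integrableOn_Ioc (by fun_prop)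
  have hcomp : ∀ t : ℝ, exp (-(v * t)) ^ (u / v) = exp (-(u * t)) := fun t ↦ by
    rw [← exp_mul]; congr 1; field_simp
  have hJ := (convexOn_rpow ((one_le_div hv).2 hvu)).map_integral_le
    (μ := volume.restrict (Set.Ioc (0 : ℝ) 1)) (f := fun t ↦ exp (-(v * t)))
    (continuousOn_id.rpow_const fun _ _ ↦ Or.inr (by positivity)) isClosed_Ici
    (Filter.Eventually.of_forall fun t ↦ (exp_pos _).le) (hint v)
    (by simpa only [Function.comp_def, hcomp] using hint u)
  simp only [hcomp, ← intervalIntegral.integral_of_le zero_le_one, key v hv, key u hu] at hJ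
  have hlog := log_le_log (rpow_pos_of_pos (one_sub_exp_neg_div_pos hv) _) hJ
  rw [log_rpow (one_sub_exp_neg_div_pos hv), div_mul_eq_mul_div, div_le_iff₀ hv] at hlog
  linarith

theorem gammaPDFReal_natCast_succ (n : ℕ) {r s t : ℝ} (hr : 0 < r) (hs : 0 < s)
    (hsn : s ^ (n + 1) * (n + 1).factorial = 1) (ht : 0 < t) :
    gammaPDFReal ((n + 1 : ℕ) : ℝ) r t =
      (n + 1) * (r * s) * (r * s * t) ^ n * exp (-(r * s * t / s)) := by
  have h1 : r ^ (n + 1) / n.factorial = (n + 1) * (r * s) * (r * s) ^ n := by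
    rw [Nat.factorial_succ] at hsn
    push_cast at hsn
    rw [div_eq_iff (by positivity)]
    linear_combination -r ^ (n + 1) * hsn
  have h2 : r * s * t / s = r * t := by field_simp
  have h3 : (((n + 1 : ℕ) : ℝ) - 1) = n := by push_cast; ring
  rw [gammaPDFReal, if_pos ht.le, h3, rpow_natCast, rpow_natCast, h2, mul_pow (r * s), ← mul_assoc,
    ← h1]
  push_cast
  rw [Gamma_nat_eq_factorial]

theorem hasDerivAt_one_sub_exp_neg_pow (n : ℕ) (c t : ℝ) :
    HasDerivAt (fun t ↦ (1 - exp (-(c * t))) ^ (n + 1))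
      ((n + 1) * c * (exp (-(c * t)) * (1 - exp (-(c * t))) ^ n)) t := by
  have := ((((hasDerivAt_id' t).const_mul c).fun_neg).exp.const_sub 1).fun_pow (n + 1)
  exact this.congr_deriv (by push_cast [Nat.add_sub_cancel]; ring)

theorem exp_neg_mul_one_sub_exp_neg_pow (n : ℕ) {u : ℝ} (hu : 0 < u) :
    exp (-u) * (1 - exp (-u)) ^ n = u ^ n * exp (n * log ((1 - exp (-u)) / u) - u) := by
  rw [exp_sub, exp_nat_mul, exp_log (one_sub_exp_neg_div_pos hu), div_pow, exp_neg]
  field_simp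

/-- Alzer's inequality for integer shape, in terms of the tail of the Gamma distribution. -/
theorem gammaMeasure_Ioi_toReal_le (n : ℕ) {r s x : ℝ} (hr : 0 < r) (hs : 0 < s)
    (hsn : s ^ (n + 1) * (n + 1).factorial = 1) (hx : 0 ≤ x) :
    (gammaMeasure ((n + 1 : ℕ) : ℝ) r (Set.Ioi x)).toReal ≤
      1 - (1 - exp (-(r * s * x))) ^ (n + 1) := by
  have ha : (0 : ℝ) < ((n + 1 : ℕ) : ℝ) := by positivity
  have hprob := isProbabilityMeasure_gammaMeasure ha hr
  rcases hx.eq_or_lt with rfl | hx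
  · simpa [measureReal_def] using
      measureReal_le_one (μ := gammaMeasure ((n + 1 : ℕ) : ℝ) r) (s := Set.Ioi 0)
  have hc : 0 < r * s := by positivity
  set g : ℝ → ℝ := fun t ↦ (n + 1) * (r * s) * (exp (-(r * s * t)) * (1 - exp (-(r * s * t))) ^ n)
    with hg
  have hg_eq : ∀ t, 0 < t → g t = (n + 1) * (r * s) * (r * s * t) ^ n *
      exp (n * log ((1 - exp (-(r * s * t))) / (r * s * t)) - r * s * t) := fun t ht ↦ by
    rw [hg]
    beta_reduce
    rw [exp_neg_mul_one_sub_exp_neg_pow n (mul_pos hc ht)]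
    ring
  have hg_nonneg : ∀ t, 0 < t → 0 ≤ g t := fun t ht ↦ by
    rw [hg_eq t ht]; positivity
  have hint : Integrable (gammaPDFReal ((n + 1 : ℕ) : ℝ) r) := by
    refine ⟨by fun_prop, ?_⟩
    rw [hasFiniteIntegral_iff_ofReal (Filter.Eventually.of_forall (gammaPDFReal_nonneg ha hr))]
    exact (lintegral_gammaPDF_eq_one ha hr).trans_lt ENNReal.one_lt_top
  have hmeas : ∀ S : Set ℝ, MeasurableSet S → (gammaMeasure ((n + 1 : ℕ) : ℝ) r S).toReal =
      ∫ t in S, gammaPDFReal ((n + 1 : ℕ) : ℝ) r t := fun S hS ↦ by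
    rw [gammaMeasure, withDensity_apply _ hS]
    exact (integral_eq_lintegral_of_nonneg_ae
      (Filter.Eventually.of_forall (gammaPDFReal_nonneg ha hr)) (by fun_prop)).symm
  have hlog : ∀ v u : ℝ, 0 < v → v ≤ u →
      u * (n * log ((1 - exp (-v)) / v)) ≤ v * (n * log ((1 - exp (-u)) / u)) := fun v u hv hvu ↦ by
    have := mul_le_mul_of_nonneg_left (mul_log_one_sub_exp_neg_div_le hv hvu) n.cast_nonneg
    linarith
  rcases le_total (n * log ((1 - exp (-(r * s * x))) / (r * s * x)) - r * s * x)
    (-(r * s * x / s)) with h | h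
  · have hle : ∀ t ∈ Set.Ioc 0 x, g t ≤ gammaPDFReal ((n + 1 : ℕ) : ℝ) r t := by
      rintro t ⟨ht, htx⟩
      rw [hg_eq t ht, gammaPDFReal_natCast_succ n hr hs hsn ht]
      gcongr
      have hu : 0 < r * s * x := by positivity
      have h1 := hlog _ _ (mul_pos hc ht) (mul_le_mul_of_nonneg_left htx hc.le)
      have h2 := mul_le_mul_of_nonneg_left h (mul_pos hc ht).le
      refine le_of_mul_le_mul_left ?_ hu
      have e : r * s * t * (-(r * s * x / s)) = r * s * x * (-(r * s * t / s)) := by ring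
      linarith
    have hftc : ∫ t in Set.Ioc 0 x, g t = (1 - exp (-(r * s * x))) ^ (n + 1) := by
      rw [← intervalIntegral.integral_of_le hx.le,
        intervalIntegral.integral_eq_sub_of_hasDerivAt
          (fun t _ ↦ hasDerivAt_one_sub_exp_neg_pow n (r * s) t)
          (Continuous.intervalIntegrable (by fun_prop) _ _)]
      simp
    have h1 := setIntegral_mono_on (Continuous.integrableOn_Ioc (by fun_prop)) hint.integrableOn
      measurableSet_Ioc hle
    rw [hftc, ← hmeas _ measurableSet_Ioc] at h1
    have h2 : (gammaMeasure ((n + 1 : ℕ) : ℝ) r).real (Set.Ioc 0 x ∪ Set.Ioi x) ≤ 1 :=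
      measureReal_le_one
    rw [measureReal_union (Set.Ioc_disjoint_Ioi le_rfl) measurableSet_Ioi] at h2
    simp only [measureReal_def] at h2
    linarith
  · have hle : ∀ t ∈ Set.Ioi x, gammaPDFReal ((n + 1 : ℕ) : ℝ) r t ≤ g t := by
      intro t hxt
      have hxt : x < t := hxt
      have ht : 0 < t := hx.trans hxt
      rw [hg_eq t ht, gammaPDFReal_natCast_succ n hr hs hsn ht]
      gcongr
      have hu : 0 < r * s * x := by positivity
      have h1 := hlog _ _ hu (mul_le_mul_of_nonneg_left hxt.le hc.le)
      have h2 := mul_le_mul_of_nonneg_left h (mul_pos hc ht).le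
      refine le_of_mul_le_mul_left ?_ hu
      have e : r * s * t * (-(r * s * x / s)) = r * s * x * (-(r * s * t / s)) := by ring
      linarith
    have hlim : Filter.Tendsto (fun t ↦ (1 - exp (-(r * s * t))) ^ (n + 1)) Filter.atTop
        (nhds 1) := by
      have := ((tendsto_exp_neg_atTop_nhds_zero.comp
        (Filter.tendsto_id.const_mul_atTop hc)).const_sub 1).pow (n + 1)
      simpa [Function.comp_def] using this
    have hderiv : ∀ t ∈ Set.Ici x,
        HasDerivAt (fun t ↦ (1 - exp (-(r * s * t))) ^ (n + 1)) (g t) t :=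
      fun t _ ↦ hasDerivAt_one_sub_exp_neg_pow n (r * s) t
    have hpos : ∀ t ∈ Set.Ioi x, 0 ≤ g t := fun t ht ↦ hg_nonneg t (hx.trans ht)
    rw [hmeas _ measurableSet_Ioi,
      ← integral_Ioi_of_hasDerivAt_of_nonneg' hderiv hpos hlim]
    exact setIntegral_mono_on hint.integrableOn
      (integrableOn_Ioi_deriv_of_nonneg' hderiv hpos hlim) measurableSet_Ioi hle

theorem one_sub_one_sub_pow {R : Type*} [CommRing R] (y : R) (m : ℕ) :
    1 - (1 - y) ^ m = ∑ k ∈ Finset.Icc 1 m, (m.choose k : R) * (-1) ^ (k + 1) * y ^ k := by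
  rw [sub_eq_neg_add 1 y, add_pow, Finset.range_eq_Ico, Finset.sum_eq_sum_Ico_succ_bot (by lia)]
  have : Finset.Ico (0 + 1) (m + 1) = Finset.Icc 1 m := by ext; simp
  simp only [this, pow_zero, one_pow, mul_one, Nat.choose_zero_right, Nat.cast_one,
    sub_add_cancel_left, ← Finset.sum_neg_distrib]
  refine Finset.sum_congr rfl fun k _ ↦ ?_
  rw [neg_pow y, pow_succ]
  ring

/-- Disintegration of the event `f Y < X` along `Y`, for independent `X` and `Y`. -/
theorem measure_lt_eq_lintegral_map_Ioi {Ω : Type*} [MeasurableSpace Ω] {P : Measure Ω}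
    [IsProbabilityMeasure P] {X Y : Ω → ℝ} (hX : Measurable X) (hY : Measurable Y)
    (h : IndepFun X Y P) {f : ℝ → ℝ} (hf : Measurable f) :
    P {ω | f (Y ω) < X ω} = ∫⁻ ω, P.map X (Set.Ioi (f (Y ω))) ∂P := by
  have : IsProbabilityMeasure (P.map X) := Measure.isProbabilityMeasure_map hX.aemeasurable
  have : IsProbabilityMeasure (P.map Y) := Measure.isProbabilityMeasure_map hY.aemeasurable
  have hS : MeasurableSet {p : ℝ × ℝ | f p.2 < p.1} :=
    measurableSet_lt (hf.comp measurable_snd) measurable_fst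
  have h1 := Measure.map_apply (μ := P) (hX.prodMk hY) hS
  rw [(indepFun_iff_map_prod_eq_prod_map_map hX.aemeasurable hY.aemeasurable).1 h,
    Measure.prod_apply_symm hS, lintegral_map (measurable_measure_prodMk_right hS) hY] at h1
  exact h1.symm

/-- Binomial-expansion upper bound on the coverage probability: if `h₀` is normalized
Gamma (shape `m`, rate `m`), independent of the nonnegative interference `I`, then
`P(h₀ > γ̃ (σ² + I)) ≤ ∑_{k=1}^m C(m,k) (-1)^{k+1} e^{-k m m̃ γ̃ σ²} E[e^{-k m m̃ γ̃ I}]`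
where `m̃ = (m!)^{-1/m}`. -/
theorem coverage_probability_binomial_bound
    {Ω : Type*} [MeasurableSpace Ω] (P : Measure Ω) [IsProbabilityMeasure P]
    (m : ℕ) (hm : 0 < m) (mt : ℝ) (hmt : mt = (m.factorial : ℝ) ^ (-(1 : ℝ) / m))
    (σ2 : ℝ) (hσ2 : 0 ≤ σ2) (γt : ℝ) (hγt : 0 < γt)
    (h0 I : Ω → ℝ) (hh0meas : Measurable h0) (hImeas : Measurable I)
    (hlaw : P.map h0 = gammaMeasure m m) (hInonneg : ∀ ω, 0 ≤ I ω)
    (hindep : IndepFun h0 I P) :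
    (P {ω | γt * (σ2 + I ω) < h0 ω}).toReal ≤
      ∑ k ∈ Finset.Icc 1 m, (m.choose k : ℝ) * (-1 : ℝ) ^ (k + 1) *
        Real.exp (-((k : ℝ) * m * mt * γt * σ2)) *
        ∫ ω, Real.exp (-((k : ℝ) * m * mt * γt * I ω)) ∂P := by
  have hm' : (0 : ℝ) < m := by exact_mod_cast hm
  have hmt_pos : 0 < mt := by rw [hmt]; positivity
  have hmt_pow : mt ^ m * m.factorial = 1 := by
    rw [hmt, ← rpow_natCast, ← rpow_mul (by positivity), div_mul_cancel₀ _ hm'.ne', rpow_neg_one,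
      inv_mul_cancel₀ (by positivity)]
  have hint : ∀ k : ℕ, Integrable (fun ω ↦ exp (-((k : ℝ) * m * mt * γt * I ω))) P := fun k ↦ by
    refine Integrable.of_bound (by fun_prop) 1 (Filter.Eventually.of_forall fun ω ↦ ?_)
    have := hInonneg ω
    rw [norm_of_nonneg (exp_pos _).le, exp_le_one_iff, neg_nonpos]
    positivity
  have hbound : ∀ ω, (gammaMeasure m m (Set.Ioi (γt * (σ2 + I ω)))).toReal ≤
      ∑ k ∈ Finset.Icc 1 m, (m.choose k : ℝ) * (-1 : ℝ) ^ (k + 1) *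
        exp (-((k : ℝ) * m * mt * γt * σ2)) * exp (-((k : ℝ) * m * mt * γt * I ω)) := fun ω ↦ by
    obtain ⟨n, rfl⟩ := Nat.exists_eq_add_one.2 hm
    have := hInonneg ω
    refine (gammaMeasure_Ioi_toReal_le n hm' hmt_pos hmt_pow (by positivity)).trans_eq ?_
    rw [one_sub_one_sub_pow]
    refine Finset.sum_congr rfl fun k _ ↦ ?_
    rw [← exp_nat_mul, mul_assoc _ (exp _) (exp _), ← exp_add]
    congr 2
    ring
  have hprob : IsProbabilityMeasure (gammaMeasure (m : ℝ) m) :=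
    isProbabilityMeasure_gammaMeasure hm' hm'
  have hmeas : Measurable fun ω ↦ gammaMeasure (m : ℝ) m (Set.Ioi (γt * (σ2 + I ω))) := by
    have : Antitone fun y ↦ gammaMeasure (m : ℝ) m (Set.Ioi y) :=
      fun _ _ h ↦ measure_mono (Set.Ioi_subset_Ioi h)
    exact this.measurable.comp (by fun_prop)
  rw [measure_lt_eq_lintegral_map_Ioi hh0meas hImeas hindep
    (f := fun y ↦ γt * (σ2 + y)) (by fun_prop), hlaw,
    ← integral_toReal hmeas.aemeasurable (Filter.Eventually.of_forall fun ω ↦ measure_lt_top _ _)]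
  simp_rw [← integral_const_mul]
  rw [← integral_finsetSum _ fun k _ ↦ (hint k).const_mul _]
  refine integral_mono ?_ (integrable_finsetSum _ fun k _ ↦ (hint k).const_mul _) hbound
  refine Integrable.of_bound hmeas.ennreal_toReal.aestronglyMeasurable 1
    (Filter.Eventually.of_forall fun ω ↦ ?_)
  rw [norm_of_nonneg ENNReal.toReal_nonneg]
  exact measureReal_le_one
end
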